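/- arXiv:2507.07686 — 2 statements merged into one kernel-verified Lean document; each statement's English description precedes it below -/
import Mathlib

section
/- Let σ₀ > 0 and n ≥ 2. Then there exist a constant C = C(n,σ₀) > 0 and an exponent αₙ > 1 such that the following holds: for every closed geodesically convex subset Σ of the closed upper hemisphere S^{n−1}_+ with 𝓗^{n−1}(Σ) ≥ σ₀, every δ ∈ (0,1), and every Lipschitz function u : Σ → ℝ, one has ∫_Σ u² d𝓗^{n−1} ≤ δ ∫_Σ |∇u|² d𝓗^{n−1} + (C/δ^{αₙ}) (∫_Σ |u| d𝓗^{n−1})². -/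
open MeasureTheory Metric Set
open scoped ENNReal InnerProductSpace Topology

noncomputable section

/-- Euclidean `n`-space. -/
abbrev En (n : ℕ) : Type := EuclideanSpace ℝ (Fin n)

/-- `(n-1)`-dimensional Hausdorff measure `𝓗^{n-1}` on `ℝⁿ`. -/
def Hm (n : ℕ) : Measure (En n) := Measure.hausdorffMeasure ((n : ℝ) - 1)

/-- The vertical unit vector `eₙ`. -/
def eN (n : ℕ) : En n :=
  if h : 0 < n then EuclideanSpace.single (⟨n - 1, by omega⟩ : Fin n) 1 else 0

/-- The closed upper unit hemisphere `S^{n-1}_+ = ∂B₁(0) ∩ {xₙ ≥ 0}`. -/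
def SpherePlus (n : ℕ) : Set (En n) := Metric.sphere 0 1 ∩ {x | 0 ≤ ⟪x, eN n⟫_ℝ}

/-- A subset `Σ` of the unit sphere is geodesically convex: normalized segments
between its points remain in `Σ` (equivalently, the cone over `Σ` is convex). -/
def GeodesicallyConvex {n : ℕ} (Sig : Set (En n)) : Prop :=
  ∀ x ∈ Sig, ∀ y ∈ Sig, ∀ t : ℝ, t ∈ Set.Icc (0 : ℝ) 1 →
    (1 - t) • x + t • y ≠ 0 →
    ‖(1 - t) • x + t • y‖⁻¹ • ((1 - t) • x + t • y) ∈ Sig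

/-- Tangential (intrinsic) gradient on the unit sphere of a function defined
ambiently (junk value where the ambient function is not differentiable). -/
def tgrad {n : ℕ} (u : En n → ℝ) (x : En n) : En n :=
  gradient u x - ⟪gradient u x, x⟫_ℝ • x

section Projection

variable {E : Type*} [NormedAddCommGroup E] [InnerProductSpace ℝ E]

/-- The radial projection onto the unit sphere of the point `x + s • y`. -/
def radialProj (s : ℝ) (x y : E) : E := ‖x + s • y‖⁻¹ • (x + s • y)

lemma norm_smul_radialProj (s : ℝ) (x y : E) (h : x + s • y ≠ 0) :
    ‖x + s • y‖ • radialProj s x y = x + s • y := by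
  rw [radialProj, smul_inv_smul₀ (norm_ne_zero_iff.mpr h)]

lemma norm_radialProj {s : ℝ} {x y : E} (h : x + s • y ≠ 0) : ‖radialProj s x y‖ = 1 := by
  rw [radialProj, norm_smul, norm_inv, norm_norm, inv_mul_cancel₀ (norm_ne_zero_iff.mpr h)]

lemma abs_sub_mul_le_of_norm_smul_sub_eq {z z' w : E} {r r' s : ℝ} (hz : ‖z‖ = 1)
    (hz' : ‖z'‖ = 1) (hw : ‖w‖ = 1) (hs : 0 ≤ s) (hr : 0 ≤ r) (hr' : 0 ≤ r')
    (h : ‖r • z - s • w‖ = ‖r' • z' - s • w‖) :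
    |r - r'| * (r + r' - s * (⟪z, w⟫_ℝ + ⟪z', w⟫_ℝ)) ≤ s * (r + r') * ‖z - z'‖ := by
  have h2 : ‖r • z - s • w‖ ^ 2 = ‖r' • z' - s • w‖ ^ 2 := by rw [h]
  simp only [norm_sub_sq_real, norm_smul, inner_smul_left, inner_smul_right, hz, hz', hw,
    Real.norm_eq_abs, mul_one, sq_abs, RCLike.conj_to_real] at h2
  have key : (r - r') * (r + r' - s * (⟪z, w⟫_ℝ + ⟪z', w⟫_ℝ))
      = s * (r + r') * ⟪z - z', w⟫_ℝ := by
    rw [inner_sub_left]; linarith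
  calc _ ≤ |r - r'| * |r + r' - s * (⟪z, w⟫_ℝ + ⟪z', w⟫_ℝ)| := by gcongr; exact le_abs_self _
    _ = s * (r + r') * |⟪z - z', w⟫_ℝ| := by
      rw [← abs_mul, key, abs_mul, abs_of_nonneg (by positivity)]
    _ ≤ _ := by
      gcongr
      simpa [hw] using abs_real_inner_le_norm (z - z') w

lemma norm_smul_sub_smul_le {z z' : E} {r r' : ℝ} (hz' : ‖z'‖ = 1) (hr : 0 ≤ r) :
    ‖r • z - r' • z'‖ ≤ r * ‖z - z'‖ + |r - r'| := by
  have : r • z - r' • z' = r • (z - z') + (r - r') • z' := by module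
  rw [this]
  refine (norm_add_le _ _).trans_eq ?_
  rw [norm_smul, norm_smul, hz', Real.norm_eq_abs, Real.norm_eq_abs, abs_of_nonneg hr, mul_one]

lemma norm_add_smul_mem_Icc {s : ℝ} {x y : E} (hx : ‖x‖ = 1) (hy : ‖y‖ = 1) (hs : 0 ≤ s) :
    ‖x + s • y‖ ∈ Icc (1 - s) (1 + s) := by
  have hsy : ‖s • y‖ = s := by rw [norm_smul, hy, mul_one, Real.norm_of_nonneg hs]
  have h1 := norm_add_le x (s • y)
  have h2 := norm_sub_le (x + s • y) (s • y)
  rw [add_sub_cancel_right] at h2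
  constructor <;> linarith

lemma unit_add_smul_ne_zero {s : ℝ} {x y : E} (hx : ‖x‖ = 1) (hy : ‖y‖ = 1) (hs : 0 ≤ s)
    (hs' : s < 1) : x + s • y ≠ 0 :=
  norm_pos_iff.mp (by have := (norm_add_smul_mem_Icc hx hy hs).1; linarith)

lemma inner_radialProj_left (s : ℝ) (x y : E) (hx : ‖x‖ = 1) :
    ⟪radialProj s x y, x⟫_ℝ = ‖x + s • y‖⁻¹ * (1 + s * ⟪x, y⟫_ℝ) := by
  rw [radialProj, inner_smul_left, inner_add_left, inner_smul_left, real_inner_self_eq_norm_sq, hx,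
    real_inner_comm]
  simp

lemma norm_add_smul_sq (s : ℝ) {x y : E} (hx : ‖x‖ = 1) (hy : ‖y‖ = 1) :
    ‖x + s • y‖ ^ 2 = 1 + 2 * s * ⟪x, y⟫_ℝ + s ^ 2 := by
  rw [norm_add_sq_real, norm_smul, inner_smul_right, hx, hy, Real.norm_eq_abs, mul_one, sq_abs]
  ring

lemma norm_sub_le_radialProj_left {s : ℝ} {x x' y : E} (hx : ‖x‖ = 1) (hx' : ‖x'‖ = 1)
    (hy : ‖y‖ = 1) (hs : 0 ≤ s) (hs' : s ≤ 1 / 4) :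
    ‖x - x'‖ ≤ 3 * ‖radialProj s x y - radialProj s x' y‖ := by
  have h0 := unit_add_smul_ne_zero hx hy hs (by linarith)
  have h0' := unit_add_smul_ne_zero hx' hy hs (by linarith)
  obtain ⟨hr1, hr2⟩ := norm_add_smul_mem_Icc hx hy hs
  obtain ⟨hr1', hr2'⟩ := norm_add_smul_mem_Icc hx' hy hs
  have e := norm_smul_radialProj s x y h0
  have e' := norm_smul_radialProj s x' y h0'
  have hz := norm_radialProj h0
  have hz' := norm_radialProj h0'
  set r := ‖x + s • y‖
  set r' := ‖x' + s • y‖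
  set z := radialProj s x y
  set z' := radialProj s x' y
  have h := abs_sub_mul_le_of_norm_smul_sub_eq (r := r) (r' := r') (s := s) hz hz' hy hs
    (by linarith) (by linarith) (by rw [e, e']; simp [hx, hx'])
  have hzy := real_inner_le_norm z y
  have hzy' := real_inner_le_norm z' y
  rw [hz, hy, mul_one] at hzy
  rw [hz', hy, mul_one] at hzy'
  have hW : 1 ≤ r + r' - s * (⟪z, y⟫_ℝ + ⟪z', y⟫_ℝ) := by nlinarith
  have h1 : |r - r'| ≤ 1 * ‖z - z'‖ := calc
    |r - r'| ≤ |r - r'| * (r + r' - s * (⟪z, y⟫_ℝ + ⟪z', y⟫_ℝ)) :=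
      le_mul_of_one_le_right (abs_nonneg _) hW
    _ ≤ s * (r + r') * ‖z - z'‖ := h
    _ ≤ 1 * ‖z - z'‖ := by gcongr; nlinarith
  have h2 : x - x' = r • z - r' • z' := by rw [e, e']; abel
  rw [h2]
  refine (norm_smul_sub_smul_le hz' (by linarith)).trans ?_
  nlinarith [norm_nonneg (z - z')]

lemma norm_sub_le_radialProj_right {s : ℝ} {x y y' : E} (hx : ‖x‖ = 1) (hy : ‖y‖ = 1)
    (hy' : ‖y'‖ = 1) (hs : 0 < s) (hs' : s ≤ 1 / 4) (hxy : 0 ≤ ⟪x, y⟫_ℝ) (hxy' : 0 ≤ ⟪x, y'⟫_ℝ) :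
    ‖y - y'‖ ≤ 3 / s ^ 3 * ‖radialProj s x y - radialProj s x y'‖ := by
  have weight : ∀ v : E, ‖v‖ = 1 → 0 ≤ ⟪x, v⟫_ℝ →
      4 / 5 * s ^ 2 ≤ ‖x + s • v‖ - ⟪radialProj s x v, x⟫_ℝ := by
    intro v hv hxv
    obtain ⟨hr1, hr2⟩ := norm_add_smul_mem_Icc hx hv hs.le
    have hrpos : 0 < ‖x + s • v‖ := by linarith
    have : ‖x + s • v‖ - ⟪radialProj s x v, x⟫_ℝ = (s * ⟪x, v⟫_ℝ + s ^ 2) / ‖x + s • v‖ := by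
      rw [inner_radialProj_left s x v hx]
      field_simp
      rw [norm_add_smul_sq s hx hv]
      ring
    rw [this, le_div_iff₀ hrpos]
    nlinarith [mul_nonneg hs.le hxv, sq_nonneg s]
  have h0 := unit_add_smul_ne_zero hx hy hs.le (by linarith)
  have h0' := unit_add_smul_ne_zero hx hy' hs.le (by linarith)
  have hW := weight y hy hxy
  have hW' := weight y' hy' hxy'
  obtain ⟨hr1, hr2⟩ := norm_add_smul_mem_Icc hx hy hs.le
  obtain ⟨hr1', hr2'⟩ := norm_add_smul_mem_Icc hx hy' hs.le
  have e := norm_smul_radialProj s x y h0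
  have e' := norm_smul_radialProj s x y' h0'
  have hz := norm_radialProj h0
  have hz' := norm_radialProj h0'
  set r := ‖x + s • y‖
  set r' := ‖x + s • y'‖
  set z := radialProj s x y
  set z' := radialProj s x y'
  have h := abs_sub_mul_le_of_norm_smul_sub_eq (r := r) (r' := r') (s := 1) hz hz' hx zero_le_one
    (by linarith) (by linarith) (by rw [e, e']; simp [norm_smul, hy, hy'])
  have h1 : |r - r'| * s ^ 2 ≤ 25 / 16 * ‖z - z'‖ := by
    have h3 : |r - r'| * (8 / 5 * s ^ 2) ≤ 5 / 2 * ‖z - z'‖ := calc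
      _ ≤ |r - r'| * (r + r' - 1 * (⟪z, x⟫_ℝ + ⟪z', x⟫_ℝ)) := by gcongr; linarith
      _ ≤ 1 * (r + r') * ‖z - z'‖ := h
      _ ≤ _ := by gcongr; linarith
    linarith
  have h2 : s • (y - y') = r • z - r' • z' := by rw [e, e']; module
  have h4 : s * ‖y - y'‖ ≤ r * ‖z - z'‖ + |r - r'| := by
    have := norm_smul_sub_smul_le (z := z) (r' := r') hz' (show 0 ≤ r by linarith)
    rwa [← h2, norm_smul, Real.norm_of_nonneg hs.le] at this
  rw [div_mul_eq_mul_div, le_div_iff₀ (by positivity)]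
  have h5 : s ^ 2 * (r * ‖z - z'‖) ≤ (1 / 4) ^ 2 * ((1 + 1 / 4) * ‖z - z'‖) := by
    gcongr; linarith
  have h6 : s ^ 2 * (s * ‖y - y'‖) ≤ s ^ 2 * (r * ‖z - z'‖ + |r - r'|) := by gcongr
  nlinarith [norm_nonneg (z - z')]

lemma norm_sub_le_radialProj_one {x y y' : E} (hx : ‖x‖ = 1) (hy : ‖y‖ = 1)
    (hy' : ‖y'‖ = 1) (hxy : x + y ≠ 0) (hxy' : x + y' ≠ 0) :
    ‖y - y'‖ ≤ 4 * ‖radialProj 1 x y - radialProj 1 x y'‖ := by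
  have inner_eq : ∀ v : E, ‖v‖ = 1 → x + (1 : ℝ) • v ≠ 0 →
      ⟪radialProj 1 x v, x⟫_ℝ = ‖x + (1 : ℝ) • v‖ / 2 := by
    intro v hv h
    have hrpos : 0 < ‖x + (1 : ℝ) • v‖ := norm_pos_iff.mpr h
    rw [inner_radialProj_left 1 x v hx]
    field_simp
    rw [norm_add_smul_sq 1 hx hv]
    ring
  have h0 : x + (1 : ℝ) • y ≠ 0 := by rwa [one_smul]
  have h0' : x + (1 : ℝ) • y' ≠ 0 := by rwa [one_smul]
  have hI := inner_eq y hy h0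
  have hI' := inner_eq y' hy' h0'
  have hr := norm_pos_iff.mpr h0
  have hr' := norm_pos_iff.mpr h0'
  have hr2 := (norm_add_smul_mem_Icc hx hy zero_le_one).2
  have e := norm_smul_radialProj 1 x y h0
  have e' := norm_smul_radialProj 1 x y' h0'
  have hz := norm_radialProj h0
  have hz' := norm_radialProj h0'
  set r := ‖x + (1 : ℝ) • y‖
  set r' := ‖x + (1 : ℝ) • y'‖
  set z := radialProj 1 x y
  set z' := radialProj 1 x y'
  have h := abs_sub_mul_le_of_norm_smul_sub_eq (r := r) (r' := r') (s := 1) hz hz' hx zero_le_one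
    hr.le hr'.le (by rw [e, e']; simp [hy, hy'])
  rw [hI, hI'] at h
  have h1 : |r - r'| ≤ 2 * ‖z - z'‖ := by
    refine le_of_mul_le_mul_right (a := r + r') ?_ (by linarith)
    linarith
  have h2 : y - y' = r • z - r' • z' := by rw [e, e']; module
  rw [h2]
  refine (norm_smul_sub_smul_le hz' hr.le).trans ?_
  nlinarith [norm_nonneg (z - z')]

lemma hasDerivAt_radialProj {s : ℝ} {x y : E} (h : x + s • y ≠ 0) (hy : ‖y‖ = 1) :
    ∃ v : E, HasDerivAt (fun t => radialProj t x y) v s ∧ ⟪radialProj s x y, v⟫_ℝ = 0 ∧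
      ‖v‖ ≤ 2 / ‖x + s • y‖ := by
  have hp : HasDerivAt (fun t : ℝ => x + t • y) y s := by
    simpa using ((hasDerivAt_id s).smul_const y).const_add x
  have hr : HasDerivAt (fun t : ℝ => ‖x + t • y‖) (⟪x + s • y, y⟫_ℝ / ‖x + s • y‖) s := by
    have h1 := hp.norm_sq.sqrt (by positivity)
    simp only [Real.sqrt_sq (norm_nonneg _)] at h1
    convert h1 using 1
    field_simp
  have hpos : 0 < ‖x + s • y‖ := norm_pos_iff.mpr h
  have hv := (hr.fun_inv hpos.ne').smul hp
  refine ⟨_, hv, ?_, ?_⟩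
  · have h1 : ⟪x + s • y, x + s • y⟫_ℝ = ‖x + s • y‖ ^ 2 := real_inner_self_eq_norm_sq _
    rw [radialProj]
    generalize x + s • y = p at *
    simp only [inner_add_right, inner_smul_left, inner_smul_right, RCLike.conj_to_real,
      h1]
    field_simp
    ring
  · have h3 := abs_real_inner_le_norm (x + s • y) y
    generalize x + s • y = p at *
    rw [hy, mul_one] at h3
    refine (norm_add_le _ _).trans ?_
    have h4 : |⟪p, y⟫_ℝ| / ‖p‖ ≤ 1 := div_le_one_of_le₀ h3 hpos.le
    calc _ = 1 / ‖p‖ + |⟪p, y⟫_ℝ| / ‖p‖ / ‖p‖ := by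
          rw [norm_smul, norm_smul, hy, norm_div, norm_neg, norm_div, norm_inv, norm_pow, norm_norm,
            Real.norm_eq_abs]
          field_simp
      _ ≤ 1 / ‖p‖ + 1 / ‖p‖ := by gcongr
      _ = 2 / ‖p‖ := by ring

lemma measurable_radialProj [MeasurableSpace E] [BorelSpace E] [SecondCountableTopology E] :
    Measurable (fun p : ℝ × E × E => radialProj p.1 p.2.1 p.2.2) := by
  unfold radialProj
  fun_prop

end Projection

section Measure

lemma lintegral_comp_le_of_dist_le {X : Type*} [MetricSpace X] [MeasurableSpace X] [BorelSpace X]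
    {d : ℝ} (hd : 0 ≤ d) {A B : Set X} {g : X → X} (hg : Measurable g)
    (hgAB : MapsTo g A B) (K : NNReal)
    (hK : ∀ x ∈ A, ∀ y ∈ A, dist x y ≤ K * dist (g x) (g y)) {f : X → ℝ≥0∞} (hf : Measurable f) :
    ∫⁻ x in A, f (g x) ∂(Measure.hausdorffMeasure d) ≤
      (K : ℝ≥0∞) ^ d * ∫⁻ x in B, f x ∂(Measure.hausdorffMeasure d) := by
  have hle : ((Measure.hausdorffMeasure d).restrict A).map g ≤
      (K : ℝ≥0∞) ^ d • (Measure.hausdorffMeasure d).restrict B := by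
    refine Measure.le_iff.mpr fun S hS => ?_
    rw [Measure.map_apply hg hS, Measure.restrict_apply (hg hS), Measure.smul_apply,
      Measure.restrict_apply hS, smul_eq_mul]
    rcases isEmpty_or_nonempty X with hX | hX
    · simp [Subsingleton.elim (g ⁻¹' S ∩ A) ∅]
    have hinj : InjOn g A := fun x hx y hy hxy =>
      dist_le_zero.mp (by simpa [hxy] using hK x hx y hy)
    have hlip : LipschitzOnWith K (Function.invFunOn g A) (g '' A) := by
      refine LipschitzOnWith.of_dist_le_mul ?_
      rintro _ ⟨x, hx, rfl⟩ _ ⟨y, hy, rfl⟩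
      rw [hinj.leftInvOn_invFunOn hx, hinj.leftInvOn_invFunOn hy]
      exact hK x hx y hy
    calc _ ≤ Measure.hausdorffMeasure d (Function.invFunOn g A '' (g '' (g ⁻¹' S ∩ A))) := by
          refine measure_mono fun x hx => ⟨g x, mem_image_of_mem g hx, ?_⟩
          exact hinj.leftInvOn_invFunOn hx.2
      _ ≤ (K : ℝ≥0∞) ^ d * Measure.hausdorffMeasure d (g '' (g ⁻¹' S ∩ A)) :=
          (hlip.mono (image_mono inter_subset_right)).hausdorffMeasure_image_le hd
      _ ≤ _ := by
          gcongr
          rintro _ ⟨x, hx, rfl⟩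
          exact ⟨hx.1, hgAB hx.2⟩
  calc _ = ∫⁻ x, f x ∂(((Measure.hausdorffMeasure d).restrict A).map g) :=
        (lintegral_map hf hg).symm
    _ ≤ ∫⁻ x, f x ∂((K : ℝ≥0∞) ^ d • (Measure.hausdorffMeasure d).restrict B) :=
        lintegral_mono' hle le_rfl
    _ = _ := by rw [lintegral_smul_measure, smul_eq_mul]

lemma lintegral_sq_le {X : Type*} [MeasurableSpace X] (μ : Measure X) {f : X → ℝ≥0∞}
    (hf : AEMeasurable f μ) : (∫⁻ x, f x ∂μ) ^ 2 ≤ μ univ * ∫⁻ x, f x ^ 2 ∂μ := by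
  have h := ENNReal.lintegral_mul_le_Lp_mul_Lq μ Real.HolderConjugate.two_two
    (aemeasurable_const (b := (1 : ℝ≥0∞))) hf
  simp only [Pi.mul_apply, one_mul, lintegral_one, ENNReal.rpow_ofNat, one_pow] at h
  calc _ ≤ (μ univ ^ (1 / 2 : ℝ) * (∫⁻ x, f x ^ 2 ∂μ) ^ (1 / 2 : ℝ)) ^ 2 := by gcongr
    _ = _ := by
      rw [mul_pow, ← ENNReal.rpow_natCast, ← ENNReal.rpow_natCast, ← ENNReal.rpow_mul,
        ← ENNReal.rpow_mul]
      norm_num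

lemma ennreal_add_sq_le (a b : ℝ≥0∞) : (a + b) ^ 2 ≤ 2 * (a ^ 2 + b ^ 2) := by
  have := ENNReal.rpow_add_le_mul_rpow_add_rpow a b (p := 2) one_le_two
  norm_num at this
  exact_mod_cast this

lemma sq_le_of_mul_le_add {a P Q R m mx A : ℝ≥0∞} (hm : m ≠ 0) (hmx : mx ≠ ∞)
    (hA : A ≠ ∞) (hmA : m ≤ A * mx) (h : mx * a ≤ P + Q) (hP : P ^ 2 ≤ mx * R) :
    a ^ 2 ≤ 2 * A * m⁻¹ * R + 2 * (A * m⁻¹ * Q) ^ 2 := by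
  have hmx0 : mx ≠ 0 := by
    rintro rfl
    simp_all
  have hinv : mx⁻¹ ≤ A * m⁻¹ := by
    have hm' : m ≠ ∞ := ne_top_of_le_ne_top (ENNReal.mul_ne_top hA hmx) hmA
    rw [← div_eq_mul_inv, ENNReal.le_div_iff_mul_le (Or.inl hm) (Or.inl hm')]
    calc mx⁻¹ * m ≤ mx⁻¹ * (A * mx) := by gcongr
      _ = A * (mx⁻¹ * mx) := by ring
      _ = A := by rw [ENNReal.inv_mul_cancel hmx0 hmx, mul_one]
  have ha : a ≤ mx⁻¹ * P + mx⁻¹ * Q := calc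
    a = mx⁻¹ * (mx * a) := by rw [← mul_assoc, ENNReal.inv_mul_cancel hmx0 hmx, one_mul]
    _ ≤ mx⁻¹ * (P + Q) := by gcongr
    _ = _ := mul_add _ _ _
  calc a ^ 2 ≤ (mx⁻¹ * P + mx⁻¹ * Q) ^ 2 := by gcongr
    _ ≤ 2 * ((mx⁻¹ * P) ^ 2 + (mx⁻¹ * Q) ^ 2) := ennreal_add_sq_le _ _
    _ = 2 * (mx⁻¹ * mx⁻¹ * P ^ 2) + 2 * (mx⁻¹ * Q) ^ 2 := by ring
    _ ≤ 2 * (mx⁻¹ * mx⁻¹ * (mx * R)) + 2 * (A * m⁻¹ * Q) ^ 2 := by gcongr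
    _ = 2 * (mx⁻¹ * mx) * mx⁻¹ * R + 2 * (A * m⁻¹ * Q) ^ 2 := by ring
    _ = 2 * mx⁻¹ * R + 2 * (A * m⁻¹ * Q) ^ 2 := by
      rw [ENNReal.inv_mul_cancel hmx0 hmx, mul_one]
    _ ≤ 2 * (A * m⁻¹) * R + 2 * (A * m⁻¹ * Q) ^ 2 := by gcongr
    _ = _ := by ring

end Measure

section Gradient

variable {n : ℕ}

/-- The norm of the tangential gradient, set to `∞` where the function is not differentiable. -/
def enormTgrad (u : En n → ℝ) (x : En n) : ℝ≥0∞ :=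
  open scoped Classical in if DifferentiableAt ℝ u x then ‖tgrad u x‖ₑ else ∞

lemma measurable_tgrad (u : En n → ℝ) : Measurable (tgrad u) := by
  have h : Measurable (gradient u) :=
    (InnerProductSpace.toDual ℝ (En n)).symm.continuous.measurable.comp (measurable_fderiv ℝ u)
  unfold tgrad
  fun_prop

lemma measurable_enormTgrad (u : En n → ℝ) : Measurable (enormTgrad u) := by
  classical
  exact Measurable.ite (measurableSet_of_differentiableAt ℝ u) (measurable_tgrad u).enorm
    measurable_const

lemma norm_tgrad_le {u : En n → ℝ} {L : NNReal} (hu : LipschitzWith L u) {x : En n}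
    (hx : ‖x‖ = 1) : ‖tgrad u x‖ ≤ 2 * L := by
  have h1 : ‖gradient u x‖ ≤ L := by
    rw [gradient, LinearIsometryEquiv.norm_map]
    exact norm_fderiv_le_of_lipschitz ℝ hu
  have h2 := abs_real_inner_le_norm (gradient u x) x
  rw [hx, mul_one] at h2
  refine (norm_sub_le _ _).trans ?_
  rw [norm_smul, hx, Real.norm_eq_abs]
  linarith

lemma abs_fderiv_apply_le {u : En n → ℝ} {x v : En n} (hxv : ⟪x, v⟫_ℝ = 0) :
    |fderiv ℝ u x v| ≤ ‖tgrad u x‖ * ‖v‖ := by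
  have : fderiv ℝ u x v = ⟪tgrad u x, v⟫_ℝ := by
    rw [← toDual_gradient, InnerProductSpace.toDual_apply_apply, tgrad, inner_sub_left,
      inner_smul_left, hxv, mul_zero, sub_zero]
  rw [this]
  exact abs_real_inner_le_norm _ _

lemma enorm_sub_le_lintegral_enormTgrad {u : En n → ℝ} {L : NNReal} (hu : LipschitzWith L u)
    {x y : En n} (hx : ‖x‖ = 1) (hy : ‖y‖ = 1) {s : ℝ} (hs : 0 ≤ s) (hs' : s ≤ 1 / 4) :
    ‖u x - u (radialProj s x y)‖ₑ ≤
      3 * ∫⁻ t in Ioc 0 s, enormTgrad u (radialProj t x y) := by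
  have hmeas : Measurable (fun t => radialProj t x y) :=
    measurable_radialProj.comp (f := fun t : ℝ => (t, x, y)) (by fun_prop)
  have hmeas' : Measurable (fun t => enormTgrad u (radialProj t x y)) :=
    (measurable_enormTgrad u).comp hmeas
  by_cases htop : ∫⁻ t in Ioc 0 s, enormTgrad u (radialProj t x y) = ∞
  · simp [htop]
  have hdiff : ∀ᵐ t ∂volume.restrict (Ioc 0 s), DifferentiableAt ℝ u (radialProj t x y) := by
    filter_upwards [ae_lt_top hmeas' htop] with t ht
    by_contra h
    simp [enormTgrad, h] at ht
  have hder : ∀ t ∈ Icc 0 s, ∃ v : En n, HasDerivAt (fun t => radialProj t x y) v t ∧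
      ⟪radialProj t x y, v⟫_ℝ = 0 ∧ ‖v‖ ≤ 3 := by
    intro t ht
    obtain ⟨v, h1, h2, h3⟩ := hasDerivAt_radialProj
      (unit_add_smul_ne_zero hx hy ht.1 (by linarith [ht.2])) hy
    refine ⟨v, h1, h2, h3.trans ?_⟩
    have h4 := (norm_add_smul_mem_Icc hx hy ht.1).1
    have h5 := ht.2
    rw [div_le_iff₀ (by linarith)]
    linarith
  have hlip : LipschitzOnWith (L * 3) (fun t => u (radialProj t x y)) (uIcc 0 s) := by
    rw [uIcc_of_le hs]
    refine hu.comp_lipschitzOnWith (g := fun t => radialProj t x y) ?_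
    choose! v hv using hder
    exact (convex_Icc 0 s).lipschitzOnWith_of_nnnorm_hasDerivWithin_le (f' := v)
      (fun t ht => (hv t ht).1.hasDerivWithinAt) (fun t ht => (hv t ht).2.2)
  have hftc := hlip.absolutelyContinuousOnInterval.integral_deriv_eq_sub
  have h0 : radialProj 0 x y = x := by simp [radialProj, hx]
  rw [h0] at hftc
  rw [← enorm_neg, neg_sub, ← hftc, intervalIntegral.integral_of_le hs]
  refine (enorm_integral_le_lintegral_enorm _).trans ?_
  rw [← lintegral_const_mul _ hmeas']
  refine lintegral_mono_ae ?_
  filter_upwards [hdiff, ae_restrict_mem measurableSet_Ioc] with t ht htm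
  obtain ⟨v, h1, h2, h3⟩ := hder t (Ioc_subset_Icc_self htm)
  have hd : HasDerivAt (fun t => u (radialProj t x y)) (fderiv ℝ u (radialProj t x y) v) t :=
    ht.hasFDerivAt.comp_hasDerivAt t h1
  rw [hd.deriv, enormTgrad, if_pos ht, ← ofReal_norm, ← ofReal_norm, Real.norm_eq_abs,
    ← ENNReal.ofReal_ofNat 3, ← ENNReal.ofReal_mul (by norm_num)]
  refine ENNReal.ofReal_le_ofReal ((abs_fderiv_apply_le h2).trans ?_)
  rw [mul_comm]
  gcongr

end Gradient

section Convex

variable {n : ℕ} {Sig : Set (En n)}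

lemma GeodesicallyConvex.radialProj_mem (hconv : GeodesicallyConvex Sig) {x y : En n}
    (hx : x ∈ Sig) (hy : y ∈ Sig) {s : ℝ} (hs : 0 ≤ s) (h : x + s • y ≠ 0) :
    radialProj s x y ∈ Sig := by
  have hs1 : 0 < 1 + s := by linarith
  have e : (1 - s / (1 + s)) • x + (s / (1 + s)) • y = (1 + s)⁻¹ • (x + s • y) := by
    rw [smul_add, smul_smul]
    congr 2 <;> field_simp
    ring
  have := hconv x hx y hy (s / (1 + s))
    ⟨by positivity, by rw [div_le_one hs1]; linarith⟩
    (by rw [e]; exact smul_ne_zero (by positivity) h)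
  rw [e, norm_smul, smul_smul, Real.norm_of_nonneg (by positivity), mul_inv, mul_right_comm,
    inv_mul_cancel₀ (by positivity), one_mul] at this
  exact this

/-- The part of a convex spherical set within distance `π / 2` of one of its points carries a fixed
proportion of the measure. -/
lemma hausdorffMeasure_le_of_geodesicallyConvex (hconv : GeodesicallyConvex Sig)
    (hSig : MeasurableSet Sig) (hS : Sig ⊆ sphere 0 1) {d : ℝ} (hd : 0 < d) {x : En n}
    (hx : x ∈ Sig) :
    Measure.hausdorffMeasure d Sig ≤
      4 ^ d * (Measure.hausdorffMeasure d).restrict Sig {y | 0 ≤ ⟪x, y⟫_ℝ} := by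
  have hnorm : ∀ y ∈ Sig, ‖y‖ = 1 := fun y hy => by simpa using hS hy
  have hG : MeasurableSet {y : En n | 0 ≤ ⟪x, y⟫_ℝ} :=
    measurableSet_le measurable_const (by fun_prop)
  have hne : ∀ y ∈ Sig \ {-x}, x + y ≠ 0 := fun y hy h =>
    hy.2 (eq_neg_of_add_eq_zero_right h)
  have := Measure.nullSingletonClass_hausdorff (En n) hd
  have h := lintegral_comp_le_of_dist_le hd.le (A := Sig \ {-x}) (B := Sig)
    (g := fun y => radialProj 1 x y) (K := 4)
    (measurable_radialProj.comp (f := fun y : En n => ((1 : ℝ), x, y)) (by fun_prop))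
    (fun y hy => hconv.radialProj_mem hx hy.1 zero_le_one (by simpa using hne y hy))
    (fun y hy y' hy' => by
      rw [dist_eq_norm, dist_eq_norm]
      exact norm_sub_le_radialProj_one (hnorm x hx) (hnorm y hy.1) (hnorm y' hy'.1) (hne y hy)
        (hne y' hy'))
    (f := indicator {y : En n | 0 ≤ ⟪x, y⟫_ℝ} 1) (measurable_one.indicator hG)
  rw [lintegral_indicator_one hG] at h
  refine le_trans ?_ (h.trans_eq (by norm_num))
  calc _ = Measure.hausdorffMeasure d (Sig \ {-x}) := (measure_sdiff_null (measure_singleton _)).symm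
    _ = ∫⁻ y in Sig \ {-x}, 1 ∂(Measure.hausdorffMeasure d) := by simp
    _ ≤ _ := by
      refine setLIntegral_mono' (hSig.diff (measurableSet_singleton _)) fun y hy => ?_
      have : radialProj 1 x y ∈ {y : En n | 0 ≤ ⟪x, y⟫_ℝ} := by
        rw [mem_ofPred_eq, real_inner_comm, inner_radialProj_left 1 x y (hnorm x hx), one_mul]
        have h1 := abs_le.mp (abs_real_inner_le_norm x y)
        rw [hnorm x hx, hnorm y hy.1] at h1
        have : 0 ≤ 1 + ⟪x, y⟫_ℝ := by linarith
        positivity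
      rw [indicator_of_mem this]
      rfl

end Convex

section Nash

variable {n : ℕ} {Sig : Set (En n)}

lemma lintegral_lintegral_sq_sub_le (hconv : GeodesicallyConvex Sig) (hSig : MeasurableSet Sig)
    (hS : Sig ⊆ sphere 0 1) {d : ℝ} (hd : 0 < d) {μ : Measure (En n)}
    (hμ : μ = (Measure.hausdorffMeasure d).restrict Sig) [IsFiniteMeasure μ]
    {u : En n → ℝ} {L : NNReal} (hu : LipschitzWith L u) {s : ℝ} (hs : 0 ≤ s) (hs' : s ≤ 1 / 4) :
    ∫⁻ x, ∫⁻ y, ‖u x - u (radialProj s x y)‖ₑ ^ 2 ∂μ ∂μ ≤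
      9 * ENNReal.ofReal s ^ 2 * μ univ * 3 ^ d * ∫⁻ x, enormTgrad u x ^ 2 ∂μ := by
  have hnorm : ∀ y ∈ Sig, ‖y‖ = 1 := fun y hy => by simpa using hS hy
  have hmem : ∀ᵐ x ∂μ, x ∈ Sig := by rw [hμ]; exact ae_restrict_mem hSig
  have hf := (measurable_enormTgrad u).pow_const 2
  have hjoint : Measurable
      (fun p : (En n × En n) × ℝ => enormTgrad u (radialProj p.2 p.1.1 p.1.2) ^ 2) :=
    hf.comp (measurable_radialProj.comp
      (f := fun p : (En n × En n) × ℝ => (p.2, p.1.1, p.1.2)) (by fun_prop))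
  have hpoint : ∀ x ∈ Sig, ∀ y ∈ Sig, ‖u x - u (radialProj s x y)‖ₑ ^ 2 ≤
      9 * ENNReal.ofReal s * ∫⁻ t in Ioc 0 s, enormTgrad u (radialProj t x y) ^ 2 := by
    intro x hx y hy
    have hmeas : Measurable (fun t => enormTgrad u (radialProj t x y)) :=
      (measurable_enormTgrad u).comp
        (measurable_radialProj.comp (f := fun t : ℝ => (t, x, y)) (by fun_prop))
    calc _ ≤ (3 * ∫⁻ t in Ioc 0 s, enormTgrad u (radialProj t x y)) ^ 2 := by
          gcongr
          exact enorm_sub_le_lintegral_enormTgrad hu (hnorm x hx) (hnorm y hy) hs hs'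
      _ = 9 * (∫⁻ t in Ioc 0 s, enormTgrad u (radialProj t x y)) ^ 2 := by
          rw [mul_pow]; norm_num
      _ ≤ 9 * (ENNReal.ofReal s * ∫⁻ t in Ioc 0 s, enormTgrad u (radialProj t x y) ^ 2) := by
          gcongr
          simpa using lintegral_sq_le (volume.restrict (Ioc 0 s)) hmeas.aemeasurable
      _ = _ := (mul_assoc _ _ _).symm
  have hslice : ∀ y ∈ Sig, ∀ t ∈ Ioc 0 s, ∫⁻ x, enormTgrad u (radialProj t x y) ^ 2 ∂μ ≤
      3 ^ d * ∫⁻ x, enormTgrad u x ^ 2 ∂μ := by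
    intro y hy t ht
    have ht' : t ≤ 1 / 4 := ht.2.trans hs'
    rw [hμ]
    exact lintegral_comp_le_of_dist_le hd.le (K := 3) (g := fun x => radialProj t x y)
      (measurable_radialProj.comp (f := fun x : En n => (t, x, y)) (by fun_prop))
      (fun x hx => hconv.radialProj_mem hx hy ht.1.le
        (unit_add_smul_ne_zero (hnorm x hx) (hnorm y hy) ht.1.le (by linarith)))
      (fun x hx x' hx' => by
        rw [dist_eq_norm, dist_eq_norm]
        exact norm_sub_le_radialProj_left (hnorm x hx) (hnorm x' hx') (hnorm y hy) ht.1.le ht')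
      hf
  calc _ ≤ ∫⁻ x, ∫⁻ y, 9 * ENNReal.ofReal s *
          (∫⁻ t in Ioc 0 s, enormTgrad u (radialProj t x y) ^ 2) ∂μ ∂μ := by
        refine lintegral_mono_ae ?_
        filter_upwards [hmem] with x hx
        refine lintegral_mono_ae ?_
        filter_upwards [hmem] with y hy
        exact hpoint x hx y hy
    _ = ∫⁻ p, 9 * ENNReal.ofReal s *
          (∫⁻ t in Ioc 0 s, enormTgrad u (radialProj t p.1 p.2) ^ 2) ∂(μ.prod μ) := by
        rw [lintegral_prod]
        exact (hjoint.lintegral_prod_right'.const_mul _).aemeasurable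
    _ = 9 * ENNReal.ofReal s *
          ∫⁻ t in Ioc 0 s, ∫⁻ p, enormTgrad u (radialProj t p.1 p.2) ^ 2 ∂(μ.prod μ) := by
        rw [lintegral_const_mul _ hjoint.lintegral_prod_right',
          lintegral_lintegral_swap hjoint.aemeasurable]
    _ ≤ 9 * ENNReal.ofReal s *
          ∫⁻ t in Ioc 0 s, μ univ * (3 ^ d * ∫⁻ x, enormTgrad u x ^ 2 ∂μ) := by
        gcongr 9 * ENNReal.ofReal s * ?_
        refine setLIntegral_mono' measurableSet_Ioc fun t ht => ?_
        have hpair : Measurable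
            (fun p : En n × En n => enormTgrad u (radialProj t p.1 p.2) ^ 2) :=
          hf.comp (measurable_radialProj.comp
            (f := fun p : En n × En n => (t, p.1, p.2)) (by fun_prop))
        rw [lintegral_prod_symm _ hpair.aemeasurable]
        calc _ ≤ ∫⁻ y, 3 ^ d * ∫⁻ x, enormTgrad u x ^ 2 ∂μ ∂μ := by
              refine lintegral_mono_ae ?_
              filter_upwards [hmem] with y hy
              exact hslice y hy t ht
          _ = _ := by rw [lintegral_const, mul_comm]
    _ = _ := by
        rw [lintegral_const, Measure.restrict_apply_univ, Real.volume_Ioc, sub_zero]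
        ring

lemma lintegral_sq_le_nash (hconv : GeodesicallyConvex Sig) (hSig : MeasurableSet Sig)
    (hS : Sig ⊆ sphere 0 1) {d : ℝ} (hd : 0 < d) {μ : Measure (En n)}
    (hμ : μ = (Measure.hausdorffMeasure d).restrict Sig) [IsFiniteMeasure μ] (hμ0 : μ univ ≠ 0)
    {u : En n → ℝ} {L : NNReal} (hu : LipschitzWith L u) {s : ℝ} (hs : 0 < s) (hs' : s ≤ 1 / 4) :
    ∫⁻ x, ‖u x‖ₑ ^ 2 ∂μ ≤
      18 * 4 ^ d * 3 ^ d * ENNReal.ofReal s ^ 2 * ∫⁻ x, enormTgrad u x ^ 2 ∂μ +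
      2 * (4 ^ d) ^ 2 * (ENNReal.ofReal (3 / s ^ 3) ^ d) ^ 2 * (μ univ)⁻¹ *
        (∫⁻ x, ‖u x‖ₑ ∂μ) ^ 2 := by
  have hnorm : ∀ y ∈ Sig, ‖y‖ = 1 := fun y hy => by simpa using hS hy
  have hmem : ∀ᵐ x ∂μ, x ∈ Sig := by rw [hμ]; exact ae_restrict_mem hSig
  have hmuniv : μ univ ≠ ∞ := measure_ne_top _ _
  have hum : Measurable u := hu.continuous.measurable
  have hdiffm : Measurable (fun p : En n × En n => ‖u p.1 - u (radialProj s p.1 p.2)‖ₑ) :=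
    ((hum.comp measurable_fst).sub (hum.comp (measurable_radialProj.comp
      (f := fun p : En n × En n => (s, p.1, p.2)) (by fun_prop)))).enorm
  set Q := ENNReal.ofReal (3 / s ^ 3) ^ d * ∫⁻ x, ‖u x‖ₑ ∂μ with hQ
  set R : En n → ℝ≥0∞ := fun x => ∫⁻ y, ‖u x - u (radialProj s x y)‖ₑ ^ 2 ∂μ
  have hRm : Measurable R := (hdiffm.pow_const 2).lintegral_prod_right'
  have hpoint : ∀ x ∈ Sig, ‖u x‖ₑ ^ 2 ≤
      2 * 4 ^ d * (μ univ)⁻¹ * R x + 2 * (4 ^ d * (μ univ)⁻¹ * Q) ^ 2 := by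
    intro x hx
    have hG : MeasurableSet {y : En n | 0 ≤ ⟪x, y⟫_ℝ} :=
      measurableSet_le measurable_const (by fun_prop)
    set G := {y : En n | 0 ≤ ⟪x, y⟫_ℝ}
    have hproj : Measurable (fun y => radialProj s x y) :=
      measurable_radialProj.comp (f := fun y : En n => (s, x, y)) (by fun_prop)
    have hDm : Measurable (fun y => ‖u x - u (radialProj s x y)‖ₑ) :=
      hdiffm.comp measurable_prodMk_left
    refine sq_le_of_mul_le_add (mx := μ G) (P := ∫⁻ y in G, ‖u x - u (radialProj s x y)‖ₑ ∂μ)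
      hμ0 (measure_ne_top _ _) (by finiteness) ?_ ?_ ?_
    · have := hausdorffMeasure_le_of_geodesicallyConvex hconv hSig hS hd hx
      rwa [← hμ, ← Measure.restrict_apply_univ Sig, ← hμ] at this
    · calc μ G * ‖u x‖ₑ = ∫⁻ y in G, ‖u x‖ₑ ∂μ := by
            rw [lintegral_const, Measure.restrict_apply_univ, mul_comm]
        _ ≤ ∫⁻ y in G, (‖u x - u (radialProj s x y)‖ₑ + ‖u (radialProj s x y)‖ₑ) ∂μ := by
            refine lintegral_mono fun y => ?_
            simpa using enorm_add_le (u x - u (radialProj s x y)) (u (radialProj s x y))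
        _ = ∫⁻ y in G, ‖u x - u (radialProj s x y)‖ₑ ∂μ +
              ∫⁻ y in G, ‖u (radialProj s x y)‖ₑ ∂μ := lintegral_add_left hDm _
        _ ≤ _ := by
            gcongr
            rw [hQ, hμ, Measure.restrict_restrict hG]
            refine lintegral_comp_le_of_dist_le hd.le (A := G ∩ Sig)
              (K := (3 / s ^ 3).toNNReal)
              (g := fun y => radialProj s x y) hproj
              (fun y hy => hconv.radialProj_mem hx hy.2 hs.le
                (unit_add_smul_ne_zero (hnorm x hx) (hnorm y hy.2) hs.le (by linarith)))
              (fun y hy y' hy' => ?_) (f := fun z => ‖u z‖ₑ) hum.enorm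
            rw [dist_eq_norm, dist_eq_norm, Real.coe_toNNReal _ (by positivity)]
            exact norm_sub_le_radialProj_right (hnorm x hx) (hnorm y hy.2) (hnorm y' hy'.2) hs hs'
              hy.1 hy'.1
    · calc _ ≤ (μ.restrict G) univ * ∫⁻ y in G, ‖u x - u (radialProj s x y)‖ₑ ^ 2 ∂μ :=
            lintegral_sq_le _ hDm.aemeasurable
        _ ≤ μ G * R x := by
            rw [Measure.restrict_apply_univ]
            gcongr
            exact setLIntegral_le_lintegral _ _
  have hinv : (μ univ)⁻¹ * μ univ = 1 := ENNReal.inv_mul_cancel hμ0 hmuniv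
  calc _ ≤ ∫⁻ x, (2 * 4 ^ d * (μ univ)⁻¹ * R x + 2 * (4 ^ d * (μ univ)⁻¹ * Q) ^ 2) ∂μ := by
        refine lintegral_mono_ae ?_
        filter_upwards [hmem] with x hx
        exact hpoint x hx
    _ = 2 * 4 ^ d * (μ univ)⁻¹ * ∫⁻ x, R x ∂μ + 2 * (4 ^ d * (μ univ)⁻¹ * Q) ^ 2 * μ univ := by
        rw [lintegral_add_left (hRm.const_mul _), lintegral_const_mul _ hRm, lintegral_const]
    _ ≤ 2 * 4 ^ d * (μ univ)⁻¹ *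
          (9 * ENNReal.ofReal s ^ 2 * μ univ * 3 ^ d * ∫⁻ x, enormTgrad u x ^ 2 ∂μ) +
          2 * (4 ^ d * (μ univ)⁻¹ * Q) ^ 2 * μ univ := by
        gcongr
        exact lintegral_lintegral_sq_sub_le hconv hSig hS hd hμ hu hs.le hs'
    _ = 18 * 4 ^ d * 3 ^ d * ENNReal.ofReal s ^ 2 * ((μ univ)⁻¹ * μ univ) *
          ∫⁻ x, enormTgrad u x ^ 2 ∂μ +
          2 * (4 ^ d) ^ 2 * (μ univ)⁻¹ * Q ^ 2 * ((μ univ)⁻¹ * μ univ) := by ring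
    _ = _ := by rw [hinv, hQ]; ring

end Nash

/-- **Nash-type inequality on convex spherical domains** (Lemma B.2 of the paper):
for `n ≥ 2` and `σ₀ > 0` there are `C = C(n,σ₀) > 0` and `αₙ > 1` such that for
every closed geodesically convex `Σ ⊆ S^{n-1}_+` with `𝓗^{n-1}(Σ) ≥ σ₀`, every
`δ ∈ (0,1)`, and every Lipschitz `u : Σ → ℝ` (extended to a Lipschitz function on
`ℝⁿ`, differentiable `𝓗^{n-1}`-a.e. on `Σ`),
`∫_Σ u² ≤ δ ∫_Σ |∇u|² + (C/δ^{αₙ}) (∫_Σ |u|)²`. -/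
theorem nash_type_inequality
    (n : ℕ) (hn : 2 ≤ n) (σ₀ : ℝ) (hσ : 0 < σ₀) :
    ∃ C : ℝ, 0 < C ∧ ∃ α : ℝ, 1 < α ∧
      ∀ Sig : Set (En n), IsClosed Sig → Sig ⊆ SpherePlus n →
        GeodesicallyConvex Sig → σ₀ ≤ (Hm n Sig).toReal →
        ∀ δ : ℝ, δ ∈ Set.Ioo (0 : ℝ) 1 →
        ∀ (u : En n → ℝ) (L : NNReal), LipschitzWith L u →
          (∀ᵐ x ∂((Hm n).restrict Sig), DifferentiableAt ℝ u x) →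
          (∫ x in Sig, (u x) ^ 2 ∂(Hm n)) ≤
            δ * (∫ x in Sig, ‖tgrad u x‖ ^ 2 ∂(Hm n)) +
              (C / δ ^ α) * (∫ x in Sig, |u x| ∂(Hm n)) ^ 2 := by
  have hn' : (2 : ℝ) ≤ n := by exact_mod_cast hn
  obtain ⟨d, hdn⟩ : ∃ d : ℝ, d = (n : ℝ) - 1 := ⟨_, rfl⟩
  have hd1 : 1 ≤ d := by linarith
  have hd : 0 < d := by linarith
  have hH : Hm n = Measure.hausdorffMeasure d := by rw [hdn]; rfl
  -- `s = √(δ / M)` turns the coefficient of the gradient term into `δ`.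
  obtain ⟨M, hM⟩ : ∃ M : ℝ, M = 18 * 4 ^ d * 3 ^ d := ⟨_, rfl⟩
  have h4 : (1 : ℝ) ≤ 4 ^ d := Real.one_le_rpow (by norm_num) hd.le
  have h3 : (1 : ℝ) ≤ 3 ^ d := Real.one_le_rpow (by norm_num) hd.le
  have hM18 : 18 ≤ M := by rw [hM]; nlinarith
  refine ⟨2 * (4 ^ d) ^ 2 * (3 ^ d) ^ 2 * M ^ (3 * d) / σ₀, by positivity, 3 * d, by linarith, ?_⟩
  intro Sig hcl hsub hconv hmass δ hδ u L hu hdiff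
  rw [hH] at hmass hdiff ⊢
  have hδ0 : 0 < δ := hδ.1
  obtain ⟨s, hs_def⟩ : ∃ s : ℝ, s = √(δ / M) := ⟨_, rfl⟩
  have hs2 : s ^ 2 = δ / M := by rw [hs_def, Real.sq_sqrt (by positivity)]
  have hs : 0 < s := by rw [hs_def]; positivity
  have hs' : s ≤ 1 / 4 := by
    refine abs_le_of_sq_le_sq' ?_ (by norm_num) |>.2
    rw [hs2, div_le_iff₀ (by linarith)]
    linarith [hδ.2]
  have hS : Sig ⊆ sphere 0 1 := hsub.trans inter_subset_left
  obtain ⟨μ, hμ⟩ : ∃ μ, μ = (Measure.hausdorffMeasure d).restrict Sig := ⟨_, rfl⟩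
  have hμuniv : μ univ = Measure.hausdorffMeasure d Sig := by rw [hμ, Measure.restrict_apply_univ]
  have htop : μ univ ≠ ∞ := by
    intro h
    rw [← hμuniv, h, ENNReal.toReal_top] at hmass
    linarith
  have hfin : IsFiniteMeasure μ := ⟨htop.lt_top⟩
  have hμ0 : μ univ ≠ 0 := by
    intro h
    rw [← hμuniv, h, ENNReal.toReal_zero] at hmass
    linarith
  rw [← hμ] at hdiff ⊢
  have hmem : ∀ᵐ x ∂μ, x ∈ Sig := by rw [hμ]; exact ae_restrict_mem hcl.measurableSet
  have hnorm : ∀ᵐ x ∂μ, ‖x‖ = 1 := hmem.mono fun x hx => by simpa using hS hx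
  have hcpt : IsCompact (sphere (0 : En n) 1) := isCompact_sphere _ _
  have huint : Integrable u μ := by
    obtain ⟨B, hB⟩ := hcpt.exists_bound_of_continuousOn hu.continuous.continuousOn
    refine Integrable.of_bound hu.continuous.aestronglyMeasurable B ?_
    exact hmem.mono fun x hx => hB x (hS hx)
  have hgint : Integrable (fun x => ‖tgrad u x‖ ^ 2) μ := by
    refine Integrable.of_bound
      ((measurable_tgrad u).norm.pow_const 2).aestronglyMeasurable ((2 * L) ^ 2) ?_
    filter_upwards [hnorm] with x hx
    rw [norm_pow, norm_norm]
    gcongr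
    exact norm_tgrad_le hu hx
  have key := lintegral_sq_le_nash hconv hcl.measurableSet hS hd hμ hμ0 hu hs hs'
  have hgrad : ∫⁻ x, enormTgrad u x ^ 2 ∂μ = ENNReal.ofReal (∫ x, ‖tgrad u x‖ ^ 2 ∂μ) := by
    rw [ofReal_integral_eq_lintegral_ofReal hgint (ae_of_all _ fun x => by positivity)]
    refine lintegral_congr_ae ?_
    filter_upwards [hdiff] with x hx
    rw [enormTgrad, if_pos hx, ENNReal.ofReal_pow (norm_nonneg _), ofReal_norm]
  have hL1 : ∫⁻ x, ‖u x‖ₑ ∂μ = ENNReal.ofReal (∫ x, |u x| ∂μ) :=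
    (ofReal_integral_norm_eq_lintegral_enorm huint).symm
  have hL2 : ∫ x, u x ^ 2 ∂μ = (∫⁻ x, ‖u x‖ₑ ^ 2 ∂μ).toReal := by
    rw [integral_eq_lintegral_of_nonneg_ae (f := fun x => u x ^ 2) 
      (ae_of_all _ fun x => sq_nonneg (u x)) (hu.continuous.pow 2).aestronglyMeasurable]
    congr 1
    refine lintegral_congr fun x => ?_
    rw [← sq_abs, ENNReal.ofReal_pow (abs_nonneg _), ← Real.norm_eq_abs, ofReal_norm]
  rw [hgrad, hL1] at key
  have hkey := ENNReal.toReal_mono (by finiteness) key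
  have hGnn : 0 ≤ ∫ x, ‖tgrad u x‖ ^ 2 ∂μ := integral_nonneg fun x => by positivity
  have hInn : 0 ≤ ∫ x, |u x| ∂μ := integral_nonneg fun x => abs_nonneg _
  rw [← hL2, ENNReal.toReal_add (by finiteness) (by finiteness)] at hkey
  simp only [ENNReal.toReal_mul, ENNReal.toReal_pow, ENNReal.toReal_inv, ← ENNReal.toReal_rpow,
    ENNReal.toReal_ofReal hGnn, ENNReal.toReal_ofReal hInn, ENNReal.toReal_ofReal hs.le,
    ENNReal.toReal_ofReal (show 0 ≤ 3 / s ^ 3 by positivity), ENNReal.toReal_ofNat] at hkey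
  refine hkey.trans ?_
  have hc1 : 18 * 4 ^ d * 3 ^ d * s ^ 2 = δ := by
    rw [← hM, hs2]; field_simp
  have hpow : ((3 / s ^ 3) ^ d) ^ 2 = (3 ^ d) ^ 2 * M ^ (3 * d) / δ ^ (3 * d) := by
    have h6 : ((s ^ 3) ^ d) ^ 2 = (δ / M) ^ (3 * d) := by
      rw [← hs2, ← Real.rpow_natCast (_ ^ d), ← Real.rpow_natCast s 3, ← Real.rpow_natCast s 2,
        ← Real.rpow_mul hs.le, ← Real.rpow_mul hs.le, ← Real.rpow_mul hs.le]
      congr 1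
      push_cast
      ring
    rw [Real.div_rpow (by norm_num) (by positivity), div_pow, h6,
      Real.div_rpow hδ0.le (by linarith)]
    field_simp
  rw [hc1, hpow]
  have hmass' : (μ univ).toReal⁻¹ ≤ σ₀⁻¹ := by
    gcongr
    rw [hμuniv]
    exact hmass
  gcongr
  calc _ ≤ 2 * (4 ^ d) ^ 2 * ((3 ^ d) ^ 2 * M ^ (3 * d) / δ ^ (3 * d)) * σ₀⁻¹ := by gcongr
    _ = _ := by field_simp
end
end

section
/- For every z, p ∈ ℝⁿ with z + p ≠ 0 and z + 2p ≠ 0, one has ⟨(z+p)/|z+p|, z⟩ ≥ ⟨(z+2p)/|z+2p|, z⟩. Equivalently, for x in the open upper half-space H⁺ = {xₙ > 0}, λ ∈ (−1,1) and x' ∈ {xₙ = 0}, one has |x − (0,−λ))/|x − (0,−λ)| − (x − (x',−λ))/|x − (x',−λ)||² ≤ |(x − (−x',−λ))/|x − (−x',−λ)| − (x − (x',−λ))/|x − (x',−λ)||². -/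
open scoped InnerProductSpace

noncomputable section

/-- Normalization `v ↦ v/‖v‖` of a vector (junk value `0` at `v = 0`). -/
def nrm {n : ℕ} (v : En n) : En n := ‖v‖⁻¹ • v

/-- Last ("vertical") coordinate `xₙ = ⟪x, eₙ⟫`. -/
def xN {n : ℕ} (x : En n) : ℝ := ⟪x, eN n⟫_ℝ

lemma inner_nrm_left {n : ℕ} (v w : En n) : ⟪nrm v, w⟫_ℝ = ‖v‖⁻¹ * ⟪v, w⟫_ℝ := by
  simp [nrm, real_inner_smul_left]

lemma nrm_zero {n : ℕ} : nrm (0 : En n) = 0 := by simp [nrm]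

lemma nrm_neg {n : ℕ} (v : En n) : nrm (-v) = -nrm v := by simp [nrm]

lemma norm_nrm {n : ℕ} {v : En n} (hv : v ≠ 0) : ‖nrm v‖ = 1 := by
  have : ‖v‖ ≠ 0 := norm_ne_zero_iff.mpr hv
  simp [nrm, norm_smul, this]

lemma nrm_add_self {n : ℕ} (v : En n) : nrm (v + v) = nrm v := by
  rw [← two_smul ℝ v, nrm, nrm, norm_smul, smul_smul]
  congr 1
  norm_num
  ring

lemma norm_nrm_sub_sq {n : ℕ} {v w : En n} (hv : v ≠ 0) (hw : w ≠ 0) :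
    ‖nrm v - nrm w‖ ^ 2 = 2 - 2 * ⟪nrm v, nrm w⟫_ℝ := by
  rw [norm_sub_sq_real, norm_nrm hv, norm_nrm hw]
  ring

lemma inner_nrm_add_two_smul_le {n : ℕ} (z p : En n) (ha : z + p ≠ 0) (hb : z + 2 • p ≠ 0) :
    ⟪nrm (z + 2 • p), z⟫_ℝ ≤ ⟪nrm (z + p), z⟫_ℝ := by
  obtain ⟨a, rfl⟩ : ∃ a, p = a - z := ⟨z + p, by abel⟩
  obtain ⟨b, rfl⟩ : ∃ b, z = (2 : ℝ) • a - b := ⟨(2 : ℝ) • a - z, by abel⟩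
  have e1 : (2 : ℝ) • a - b + (a - ((2 : ℝ) • a - b)) = a := by abel
  have e2 : (2 : ℝ) • a - b + 2 • (a - ((2 : ℝ) • a - b)) = b := by module
  rw [e1] at ha ⊢
  rw [e2] at hb ⊢
  have hA : 0 < ‖a‖ := norm_pos_iff.mpr ha
  have hB : 0 < ‖b‖ := norm_pos_iff.mpr hb
  rw [inner_nrm_left, inner_nrm_left, inner_sub_right, inner_sub_right, real_inner_smul_right,
    real_inner_smul_right, real_inner_self_eq_norm_sq, real_inner_self_eq_norm_sq,
    real_inner_comm a b]
  have hcs : ⟪a, b⟫_ℝ ≤ ‖a‖ * ‖b‖ := real_inner_le_norm a b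
  generalize ⟪a, b⟫_ℝ = s at *
  have key : ‖a‖⁻¹ * (2 * ‖a‖ ^ 2 - s) - ‖b‖⁻¹ * (2 * s - ‖b‖ ^ 2)
      = (2 * ‖a‖ + ‖b‖) * (‖a‖ * ‖b‖ - s) / (‖a‖ * ‖b‖) := by
    field_simp
    ring
  have : 0 ≤ (2 * ‖a‖ + ‖b‖) * (‖a‖ * ‖b‖ - s) / (‖a‖ * ‖b‖) :=
    div_nonneg (mul_nonneg (by positivity) (sub_nonneg.mpr hcs)) (by positivity)
  linarith

/-- The comparison holds for all `w` and `y`, also where a normalized vector vanishes. -/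
lemma norm_nrm_sub_nrm_sub_sq_le {n : ℕ} (w y : En n) :
    ‖nrm w - nrm (w - y)‖ ^ 2 ≤ ‖nrm (w + y) - nrm (w - y)‖ ^ 2 := by
  by_cases hz : w - y = 0
  · obtain rfl : w = y := sub_eq_zero.mp hz
    rw [nrm_add_self]
  by_cases hb : w + y = 0
  · obtain rfl : y = -w := (neg_eq_of_add_eq_zero_right hb).symm
    rw [sub_neg_eq_add, nrm_add_self, sub_self, norm_zero, zero_pow two_ne_zero]
    positivity
  by_cases hw : w = 0
  · subst hw
    rw [zero_sub] at hz
    have hy : y ≠ 0 := neg_ne_zero.mp hz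
    rw [zero_sub, zero_add, nrm_neg, nrm_zero, sub_neg_eq_add, zero_add, sub_neg_eq_add,
      ← two_smul ℝ, norm_smul, norm_nrm hy]
    norm_num
  rw [norm_nrm_sub_sq hw hz, norm_nrm_sub_sq hb hz]
  have e1 : w - y + y = w := by abel
  have e2 : w - y + 2 • y = w + y := by abel
  have h := inner_nrm_add_two_smul_le (w - y) y (by rwa [e1]) (by rwa [e2])
  rw [e1, e2] at h
  have hm := mul_le_mul_of_nonneg_left h (inv_nonneg.mpr (norm_nonneg (w - y)))
  rw [← real_inner_smul_right, ← real_inner_smul_right] at hm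
  change ⟪nrm (w + y), nrm (w - y)⟫_ℝ ≤ ⟪nrm w, nrm (w - y)⟫_ℝ at hm
  linarith

/-- **Elementary monotonicity of angles** (inequalities (4.18)–(4.19) of the paper):
for `z, p ∈ ℝⁿ` with `z + p ≠ 0 ≠ z + 2p`,
`⟪(z+p)/|z+p|, z⟫ ≥ ⟪(z+2p)/|z+2p|, z⟫`; equivalently, for `x` in the open upper
half-space, `λ ∈ (−1,1)` and `x' ∈ ∂H`,
`|(x−(0,−λ))/|x−(0,−λ)| − (x−(x',−λ))/|x−(x',−λ)||²
  ≤ |(x−(−x',−λ))/|x−(−x',−λ)| − (x−(x',−λ))/|x−(x',−λ)||²`. -/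
theorem angle_monotonicity_and_sharpness_inequality
    (n : ℕ) (hn : 2 ≤ n) :
    (∀ z p : En n, z + p ≠ 0 → z + 2 • p ≠ 0 →
      ⟪nrm (z + 2 • p), z⟫_ℝ ≤ ⟪nrm (z + p), z⟫_ℝ) ∧
    (∀ (x : En n) (l : ℝ) (x' : En n),
      0 < xN x → l ∈ Set.Ioo (-1 : ℝ) 1 → xN x' = 0 →
      ‖nrm (x - (0 - l • eN n)) - nrm (x - (x' - l • eN n))‖ ^ 2 ≤
        ‖nrm (x - (-x' - l • eN n)) - nrm (x - (x' - l • eN n))‖ ^ 2) := by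
  refine ⟨inner_nrm_add_two_smul_le, fun x l x' _ _ _ => ?_⟩
  have h := norm_nrm_sub_nrm_sub_sq_le (x + l • eN n) x'
  have e0 : x - (0 - l • eN n) = x + l • eN n := by abel
  have e1 : x - (x' - l • eN n) = x + l • eN n - x' := by abel
  have e2 : x - (-x' - l • eN n) = x + l • eN n + x' := by abel
  rwa [e0, e1, e2]
end
end
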